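/- arXiv:2502.10960 — 2 statements merged into one kernel-verified Lean document; each statement's English description precedes it below -/
import Mathlib

section
/- There exist constants C₂, C₃ > 0 such that for every N ∈ ℕ, every choice of integers 0 = n₀ < n₁ < n₂ < ⋯ < n_N, and every x ∈ {0,1}, one has Σ_{k₁,…,k_N ∈ ℤ} | P_x(𝔇_{β_{n_i}} = k_i for all i = 1,…,N) − ∏_{i=1}^N π(k_i) | ≤ C₃ Σ_{i=1}^N e^{−C₂ (n_i − n_{i−1})}. -/
open MeasureTheory Filter ProbabilityTheory

noncomputable section

/-- One-step transition probability of the urn discrepancy chain with parameter `lam`: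
from state `i`, jump to `i+1` with probability `lam^(2i-1)/(1+lam^(2i-1))` and to `i-1`
with probability `1/(1+lam^(2i-1))`. -/
def urnStep (lam : ℝ) (i j : ℤ) : ℝ :=
  if j = i + 1 then lam ^ (2 * i - 1) / (1 + lam ^ (2 * i - 1))
  else if j = i - 1 then 1 / (1 + lam ^ (2 * i - 1))
  else 0

/-- `P` is the family of laws (indexed by the starting point) of the urn discrepancy
chain with parameter `lam`, characterized by its cylinder probabilities. -/
def IsUrnChain (lam : ℝ) (P : ℤ → Measure (ℕ → ℤ)) : Prop :=
  (∀ x, IsProbabilityMeasure (P x)) ∧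
    ∀ (x : ℤ) (n : ℕ) (p : ℕ → ℤ),
      (P x {ω | ∀ i ≤ n, ω i = p i}).toReal =
        (if p 0 = x then (1 : ℝ) else 0) *
          ∏ i ∈ Finset.range n, urnStep lam (p i) (p (i + 1))

/-- Number of down-steps of the path `ω` during the time interval `[1, j]`. -/
def downCount (ω : ℕ → ℤ) (j : ℕ) : ℕ :=
  ((Finset.Icc 1 j).filter fun ℓ => ω ℓ = ω (ℓ - 1) - 1).card

/-- `betaTime ω i` is the time of the `i`-th down-step of the path `ω`. -/
def betaTime (ω : ℕ → ℤ) (i : ℕ) : ℕ :=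
  sInf {j | 1 ≤ j ∧ downCount ω j = i}

/-- The probability distribution `π(x) = lam^(x²) / Σ_y lam^(y²)` on `ℤ`. -/
def urnPi (lam : ℝ) (x : ℤ) : ℝ :=
  lam ^ (x ^ 2) / ∑' y : ℤ, lam ^ (y ^ 2)

/-- Probability that the urn discrepancy chain jumps up from `i`. -/
def upProb (lam : ℝ) (i : ℤ) : ℝ := lam ^ (2 * i - 1) / (1 + lam ^ (2 * i - 1))

/-- Probability that the urn discrepancy chain jumps down from `i`. -/
def downProb (lam : ℝ) (i : ℤ) : ℝ := 1 / (1 + lam ^ (2 * i - 1))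

section Transition

variable {lam : ℝ}

lemma upProb_nonneg (h0 : 0 < lam) (i : ℤ) : 0 ≤ upProb lam i := by
  unfold upProb; positivity

lemma downProb_nonneg (h0 : 0 < lam) (i : ℤ) : 0 ≤ downProb lam i := by
  unfold downProb; positivity

lemma downProb_add_upProb (h0 : 0 < lam) (i : ℤ) : downProb lam i + upProb lam i = 1 := by
  have : 0 < lam ^ (2 * i - 1) := by positivity
  unfold upProb downProb
  field_simp

lemma upProb_lt_one (h0 : 0 < lam) (i : ℤ) : upProb lam i < 1 := by
  have : 0 < downProb lam i := by unfold downProb; positivity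
  linarith [downProb_add_upProb h0 i]

lemma upProb_antitone (h0 : 0 < lam) (h1 : lam < 1) : Antitone (upProb lam) := by
  intro i j hij
  have hj : 0 < lam ^ (2 * j - 1) := by positivity
  have hi : 0 < lam ^ (2 * i - 1) := by positivity
  have hle : lam ^ (2 * j - 1) ≤ lam ^ (2 * i - 1) :=
    zpow_le_zpow_right_of_le_one₀ h0 h1.le (by lia)
  unfold upProb
  rw [div_le_div_iff₀ (by positivity) (by positivity)]
  nlinarith

lemma downProb_eq_zpow_mul_upProb (h0 : 0 < lam) (i : ℤ) :
    downProb lam i = lam ^ (1 - 2 * i) * upProb lam i := by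
  have h : lam ^ (1 - 2 * i) * lam ^ (2 * i - 1) = 1 := by
    rw [← zpow_add₀ h0.ne']; simp
  unfold upProb downProb
  rw [← mul_div_assoc, h]

/-- A function bounded above which is dominated by the up-jump operator is nonpositive. -/
lemma nonpos_of_le_upProb_mul (h0 : 0 < lam) (h1 : lam < 1) {f : ℤ → ℝ} {B : ℝ}
    (hB : ∀ y, f y ≤ B) (hf : ∀ y, f y ≤ upProb lam y * f (y + 1)) (y : ℤ) : f y ≤ 0 := by
  have hu0 := upProb_nonneg h0 y
  have key : ∀ (m : ℕ) (w : ℤ), y ≤ w → f w ≤ upProb lam y ^ m * max B 0 := by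
    intro m
    induction m with
    | zero => intro w _; simpa using Or.inl (hB w)
    | succ m ih =>
      intro w hw
      have hm : 0 ≤ upProb lam y ^ m * max B 0 :=
        mul_nonneg (pow_nonneg hu0 m) (le_max_right _ _)
      calc f w ≤ upProb lam w * f (w + 1) := hf w
        _ ≤ upProb lam w * (upProb lam y ^ m * max B 0) :=
          mul_le_mul_of_nonneg_left (ih (w + 1) (by lia)) (upProb_nonneg h0 w)
        _ ≤ upProb lam y * (upProb lam y ^ m * max B 0) :=
          mul_le_mul_of_nonneg_right (upProb_antitone h0 h1 hw) hm
        _ = upProb lam y ^ (m + 1) * max B 0 := by ring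
  have hlim : Tendsto (fun m : ℕ => upProb lam y ^ m * max B 0) atTop (nhds (0 * max B 0)) :=
    (tendsto_pow_atTop_nhds_zero_of_lt_one hu0 (upProb_lt_one h0 y)).mul_const _
  rw [zero_mul] at hlim
  exact ge_of_tendsto' hlim fun m => key m y le_rfl

/-- Bounded solutions of the one-step equation for the up-jumps are unique. -/
lemma eq_of_eq_add_upProb_mul (h0 : 0 < lam) (h1 : lam < 1) {f g c : ℤ → ℝ} {B : ℝ}
    (hfB : ∀ y, |f y| ≤ B) (hgB : ∀ y, |g y| ≤ B)
    (hf : ∀ y, f y = c y + upProb lam y * f (y + 1))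
    (hg : ∀ y, g y = c y + upProb lam y * g (y + 1)) (y : ℤ) : f y = g y := by
  have key := nonpos_of_le_upProb_mul h0 h1 (f := fun y => |f y - g y|) (B := B + B)
    (fun y => (abs_sub _ _).trans (add_le_add (hfB y) (hgB y))) (fun y => by
      rw [hf y, hg y, add_sub_add_left_eq_sub, ← mul_sub, abs_mul,
        abs_of_nonneg (upProb_nonneg h0 y)]) y
  exact sub_eq_zero.1 (abs_nonpos_iff.1 key)

/-- The first-step equations satisfied by the laws `K n y` of the chain started at `y` and
observed at its `n`-th down-step. -/
structure IsDownStepKernel (lam : ℝ) (K : ℕ → ℤ → ℤ → ℝ) : Prop where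
  zero : ∀ y z, K 0 y z = if y = z then 1 else 0
  nonneg : ∀ n y z, 0 ≤ K n y z
  le_one : ∀ n y z, K n y z ≤ 1
  succ : ∀ n y z, K (n + 1) y z =
    downProb lam y * K n (y - 1) z + upProb lam y * K (n + 1) (y + 1) z

namespace IsDownStepKernel

variable {K : ℕ → ℤ → ℤ → ℝ}

lemma sum_le_one (hK : IsDownStepKernel lam K) (h0 : 0 < lam) (h1 : lam < 1) (S : Finset ℤ)
    (n : ℕ) (y : ℤ) : ∑ z ∈ S, K n y z ≤ 1 := by
  induction n generalizing y with
  | zero =>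
    simp only [hK.zero, Finset.sum_ite_eq]
    split_ifs <;> norm_num
  | succ n ih =>
    have key := nonpos_of_le_upProb_mul h0 h1 (f := fun y => ∑ z ∈ S, K (n + 1) y z - 1)
      (B := ∑ z ∈ S, (1 : ℝ))
      (fun y => by linarith [Finset.sum_le_sum fun z (_ : z ∈ S) => hK.le_one (n + 1) y z])
      (fun y => by
        have hrec : ∑ z ∈ S, K (n + 1) y z = downProb lam y * ∑ z ∈ S, K n (y - 1) z +
            upProb lam y * ∑ z ∈ S, K (n + 1) (y + 1) z := by
          rw [Finset.mul_sum, Finset.mul_sum, ← Finset.sum_add_distrib]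
          exact Finset.sum_congr rfl fun z _ => hK.succ n y z
        have := mul_le_mul_of_nonneg_left (ih (y - 1)) (downProb_nonneg h0 y)
        have := downProb_add_upProb h0 y
        linarith) y
    linarith

lemma sum_abs_sub_le_two (hK : IsDownStepKernel lam K) (h0 : 0 < lam) (h1 : lam < 1)
    (S : Finset ℤ) (n m : ℕ) (x y : ℤ) : ∑ z ∈ S, |K n x z - K m y z| ≤ 2 := by
  calc ∑ z ∈ S, |K n x z - K m y z| ≤ ∑ z ∈ S, (K n x z + K m y z) :=
        Finset.sum_le_sum fun z _ => by
          have := hK.nonneg n x z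
          have := hK.nonneg m y z
          rw [abs_le]; constructor <;> linarith
    _ ≤ 2 := by
        rw [Finset.sum_add_distrib]
        linarith [hK.sum_le_one h0 h1 S n x, hK.sum_le_one h0 h1 S m y]

lemma succ_sub (hK : IsDownStepKernel lam K) (h0 : 0 < lam) (n : ℕ) (y z : ℤ) :
    K (n + 1) y z - K n (y - 1) z = upProb lam y * (K (n + 1) (y + 1) z - K n (y - 1) z) := by
  rw [hK.succ n y z]
  linear_combination K n (y - 1) z * downProb_add_upProb h0 y

lemma sum_abs_succ_sub (hK : IsDownStepKernel lam K) (h0 : 0 < lam)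
    (S : Finset ℤ) (n : ℕ) (y : ℤ) :
    ∑ z ∈ S, |K (n + 1) (y + 1) z - K (n + 1) y z| =
      lam ^ (1 - 2 * y) * ∑ z ∈ S, |K (n + 1) y z - K n (y - 1) z| := by
  rw [Finset.mul_sum]
  refine Finset.sum_congr rfl fun z _ => ?_
  have hpos : 0 < lam ^ (1 - 2 * y) := by positivity
  rw [← abs_of_pos hpos, ← abs_mul, hK.succ_sub h0, ← mul_assoc,
    ← downProb_eq_zpow_mul_upProb h0, hK.succ n y z]
  congr 1
  linear_combination -K (n + 1) (y + 1) z * downProb_add_upProb h0 y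

/-- One down-step contracts, by the factor `lam ^ 2`, the Lipschitz constant with respect to
the metric in which the edge `{y, y + 1}` has length `lam ^ (-2 y)`. -/
lemma sum_abs_sub_contract (hK : IsDownStepKernel lam K) (h0 : 0 < lam) (h1 : lam < 1)
    (S : Finset ℤ) (n : ℕ) {A : ℝ}
    (hA : ∀ y, ∑ z ∈ S, |K n (y + 1) z - K n y z| ≤ A * lam ^ (-2 * y)) (y : ℤ) :
    ∑ z ∈ S, |K (n + 1) (y + 1) z - K (n + 1) y z| ≤ lam ^ 2 * A * lam ^ (-2 * y) := by
  have key := nonpos_of_le_upProb_mul h0 h1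
    (f := fun y => ∑ z ∈ S, |K (n + 1) y z - K n (y - 1) z| - lam * A) (B := 2 - lam * A)
    (fun y => by linarith [hK.sum_abs_sub_le_two h0 h1 S (n + 1) n y (y - 1)])
    (fun y => by
      have h2 : ∑ z ∈ S, |K (n + 1) y z - K n (y - 1) z| =
          upProb lam y * ∑ z ∈ S, |K (n + 1) (y + 1) z - K n (y - 1) z| := by
        rw [Finset.mul_sum]
        refine Finset.sum_congr rfl fun z _ => ?_
        rw [hK.succ_sub h0, abs_mul, abs_of_nonneg (upProb_nonneg h0 y)]
      have h3 : ∑ z ∈ S, |K (n + 1) (y + 1) z - K n (y - 1) z| ≤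
          ∑ z ∈ S, |K (n + 1) (y + 1) z - K n y z| + A * lam ^ (-2 * (y - 1)) := by
        refine le_trans ?_ (add_le_add_right (hA (y - 1)) _)
        rw [← Finset.sum_add_distrib, sub_add_cancel]
        exact Finset.sum_le_sum fun z _ => abs_sub_le _ _ _
      have h4 : lam * A = upProb lam y * (lam * A + A * lam ^ (-2 * (y - 1))) := by
        have e1 : lam ^ (-2 * (y - 1)) = lam * lam ^ (1 - 2 * y) := by
          rw [← zpow_one_add₀ h0.ne']; congr 1; ring
        have e2 := downProb_eq_zpow_mul_upProb h0 y
        have e3 := downProb_add_upProb h0 y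
        rw [e1]
        linear_combination lam * A * e2 - lam * A * e3
      simp only [add_sub_cancel_right]
      have h5 := mul_le_mul_of_nonneg_left h3 (upProb_nonneg h0 y)
      linarith) y
  have hpos : 0 < lam ^ (1 - 2 * y) := by positivity
  have e1 : lam ^ (1 - 2 * y) = lam * lam ^ (-2 * y) := by
    rw [← zpow_one_add₀ h0.ne']; congr 1; ring
  rw [hK.sum_abs_succ_sub h0]
  calc _ ≤ lam ^ (1 - 2 * y) * (lam * A) :=
        mul_le_mul_of_nonneg_left (by linarith) hpos.le
    _ = _ := by rw [e1]; ring

lemma sum_abs_sub_succ_le (hK : IsDownStepKernel lam K) (h0 : 0 < lam) (h1 : lam < 1)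
    (S : Finset ℤ) (n : ℕ) (y : ℤ) :
    ∑ z ∈ S, |K (n + 1) (y + 1) z - K (n + 1) y z| ≤
      2 * lam * (lam ^ 2) ^ n * lam ^ (-2 * y) := by
  induction n generalizing y with
  | zero =>
    have e1 : lam ^ (1 - 2 * y) = lam * lam ^ (-2 * y) := by
      rw [← zpow_one_add₀ h0.ne']; congr 1; ring
    rw [hK.sum_abs_succ_sub h0]
    calc _ ≤ lam ^ (1 - 2 * y) * 2 :=
          mul_le_mul_of_nonneg_left (hK.sum_abs_sub_le_two h0 h1 S _ _ _ _) (by positivity)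
      _ = _ := by rw [e1]; ring
  | succ n ih =>
    exact (hK.sum_abs_sub_contract h0 h1 S (n + 1) ih y).trans_eq (by ring)


lemma sum_abs_sub_le_of_le (hK : IsDownStepKernel lam K) (h0 : 0 < lam) (h1 : lam < 1)
    (S : Finset ℤ) {n : ℕ} (hn : 0 < n) {x y : ℤ} (hxy : x ≤ y) :
    ∑ z ∈ S, |K n y z - K n x z| ≤
      2 * lam / (1 - lam ^ 2) * (lam ^ 2) ^ n * (lam ^ (-2 * y) - lam ^ (-2 * x)) := by
  obtain ⟨m, rfl⟩ := Nat.exists_eq_add_one.2 hn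
  have h2 : 0 < 1 - lam ^ 2 := by nlinarith
  induction y, hxy using Int.leInduction with
  | base => simp
  | succ y _ ih =>
    have e1 : lam ^ (-2 * y) = lam ^ 2 * lam ^ (-2 * (y + 1)) := by
      rw [← zpow_natCast, ← zpow_add₀ h0.ne']; congr 1; push_cast; ring
    calc ∑ z ∈ S, |K (m + 1) (y + 1) z - K (m + 1) x z|
        ≤ ∑ z ∈ S, |K (m + 1) (y + 1) z - K (m + 1) y z| +
          ∑ z ∈ S, |K (m + 1) y z - K (m + 1) x z| := by
          rw [← Finset.sum_add_distrib]
          exact Finset.sum_le_sum fun z _ => abs_sub_le _ _ _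
      _ ≤ _ := add_le_add (hK.sum_abs_sub_succ_le h0 h1 S m y) ih
      _ = _ := by
        rw [e1]
        field_simp
        ring

lemma sum_abs_sub_le (hK : IsDownStepKernel lam K) (h0 : 0 < lam) (h1 : lam < 1)
    (S : Finset ℤ) {n : ℕ} (hn : 0 < n) (x y : ℤ) :
    ∑ z ∈ S, |K n x z - K n y z| ≤
      2 * lam / (1 - lam ^ 2) * (lam ^ 2) ^ n * (lam ^ (-2 * x) + lam ^ (-2 * y)) := by
  have h2 : 0 < 1 - lam ^ 2 := by nlinarith
  have hx : 0 < lam ^ (-2 * x) := by positivity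
  have hy : 0 < lam ^ (-2 * y) := by positivity
  rcases le_total x y with h | h
  · simp_rw [abs_sub_comm (K n x _)]
    refine (hK.sum_abs_sub_le_of_le h0 h1 S hn h).trans ?_
    gcongr
    linarith
  · refine (hK.sum_abs_sub_le_of_le h0 h1 S hn h).trans ?_
    gcongr
    linarith

end IsDownStepKernel

lemma summable_zpow_sq (h0 : 0 < lam) (h1 : lam < 1) : Summable fun y : ℤ => lam ^ (y ^ 2) := by
  have hle : ∀ k : ℕ, lam ^ ((k : ℤ) ^ 2) ≤ lam ^ k := fun k => by
    rw [← zpow_natCast]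
    exact zpow_le_zpow_right_of_le_one₀ h0 h1.le (Int.le_self_sq k)
  have hnat : Summable fun k : ℕ => lam ^ ((k : ℤ) ^ 2) :=
    Summable.of_nonneg_of_le (fun k => (zpow_pos h0 _).le) hle
      (summable_geometric_of_lt_one h0.le h1)
  refine Summable.of_nat_of_neg (f := fun y : ℤ => lam ^ (y ^ 2)) hnat ?_
  simpa only [neg_sq] using hnat

lemma tsum_zpow_sq_pos (h0 : 0 < lam) (h1 : lam < 1) : 0 < ∑' y : ℤ, lam ^ (y ^ 2) :=
  (summable_zpow_sq h0 h1).tsum_pos (fun y => by positivity) 0 (by positivity)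

lemma urnPi_nonneg (h0 : 0 < lam) (y : ℤ) : 0 ≤ urnPi lam y :=
  div_nonneg (by positivity) (tsum_nonneg fun _ => by positivity)

lemma hasSum_urnPi (h0 : 0 < lam) (h1 : lam < 1) : HasSum (urnPi lam) 1 := by
  have h := (summable_zpow_sq h0 h1).hasSum.div_const (∑' y : ℤ, lam ^ (y ^ 2))
  rwa [div_self (tsum_zpow_sq_pos h0 h1).ne'] at h

lemma hasSum_urnPi_mul_zpow (h0 : 0 < lam) (h1 : lam < 1) :
    HasSum (fun y => urnPi lam y * lam ^ (-2 * y)) lam⁻¹ := by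
  have h := ((Equiv.subRight (1 : ℤ)).hasSum_iff.2 (hasSum_urnPi h0 h1)).mul_left lam⁻¹
  rw [mul_one] at h
  refine h.congr_fun fun y => ?_
  have e : lam ^ (y ^ 2) * lam ^ (-2 * y) = lam⁻¹ * lam ^ ((y - 1) ^ 2) := by
    rw [← zpow_neg_one, ← zpow_add₀ h0.ne', ← zpow_add₀ h0.ne']; congr 1; ring
  simp only [Function.comp, Equiv.subRight_apply, urnPi]
  rw [div_mul_eq_mul_div, e, mul_div_assoc]

namespace IsDownStepKernel

variable {K : ℕ → ℤ → ℤ → ℝ}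

/-- `urnPi` is invariant for the chain observed at its down-steps. -/
lemma hasSum_urnPi_mul (hK : IsDownStepKernel lam K) (h0 : 0 < lam) (h1 : lam < 1)
    (n : ℕ) (z : ℤ) : HasSum (fun y => urnPi lam y * K n y z) (urnPi lam z) := by
  induction n with
  | zero =>
    simp only [hK.zero, mul_ite, mul_one, mul_zero]
    convert hasSum_ite_eq z (urnPi lam z) using 3 with y h
    rw [h]
  | succ n ih =>
    have hs : Summable fun y => urnPi lam y * K (n + 1) y z :=
      (hasSum_urnPi h0 h1).summable.of_nonneg_of_le
        (fun y => mul_nonneg (urnPi_nonneg h0 y) (hK.nonneg _ _ _))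
        (fun y => mul_le_of_le_one_right (urnPi_nonneg h0 y) (hK.le_one _ _ _))
    have hs' : Summable fun y => urnPi lam (y - 1) * K (n + 1) y z :=
      ((Equiv.subRight (1 : ℤ)).summable_iff.2 (hasSum_urnPi h0 h1).summable).of_nonneg_of_le
        (fun y => mul_nonneg (urnPi_nonneg h0 _) (hK.nonneg _ _ _))
        (fun y => mul_le_of_le_one_right (urnPi_nonneg h0 _) (hK.le_one _ _ _))
    have hs'' := (Equiv.addRight (1 : ℤ)).hasSum_iff.2 hs'.hasSum
    have ih' := (Equiv.subRight (1 : ℤ)).hasSum_iff.2 ih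
    have hsum := (hs.hasSum.add hs'.hasSum).sub hs''
    have heq : (fun y => urnPi lam y * K n y z) ∘ Equiv.subRight (1 : ℤ) = fun y =>
        urnPi lam y * K (n + 1) y z + urnPi lam (y - 1) * K (n + 1) y z -
          ((fun y => urnPi lam (y - 1) * K (n + 1) y z) ∘ Equiv.addRight (1 : ℤ)) y := by
      funext y
      have e1 : lam ^ (y ^ 2) = lam ^ (2 * y - 1) * lam ^ ((y - 1) ^ 2) := by
        rw [← zpow_add₀ h0.ne']; congr 1; ring
      have e2 : 0 < lam ^ (2 * y - 1) := by positivity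
      have e3 := hK.succ n y z
      have e4 := tsum_zpow_sq_pos h0 h1
      simp only [Function.comp, Equiv.subRight_apply, Equiv.coe_addRight, add_sub_cancel_right,
        urnPi, e1]
      unfold upProb downProb at e3
      rw [e3]
      field_simp
      ring
    rw [heq] at ih'
    have := ih'.unique hsum
    rw [this, add_sub_cancel_right]
    exact hs.hasSum

lemma sum_abs_sub_urnPi_le (hK : IsDownStepKernel lam K) (h0 : 0 < lam) (h1 : lam < 1)
    (S : Finset ℤ) {n : ℕ} (hn : 0 < n) (x : ℤ) :
    ∑ z ∈ S, |K n x z - urnPi lam z| ≤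
      2 * lam / (1 - lam ^ 2) * (lam ^ 2) ^ n * (lam ^ (-2 * x) + lam⁻¹) := by
  set s : ℤ → ℝ := fun z => (SignType.sign (K n x z - urnPi lam z) : ℝ)
  have hs : ∀ z, |s z| ≤ 1 := fun z => by
    rcases (SignType.sign (K n x z - urnPi lam z)).trichotomy with h | h | h <;> simp [s, h]
  have hl : HasSum (fun y => ∑ z ∈ S, s z * (urnPi lam y * (K n x z - K n y z)))
      (∑ z ∈ S, s z * (K n x z - urnPi lam z)) :=
    hasSum_sum fun z _ => by
      simpa [mul_sub] using (((hasSum_urnPi h0 h1).mul_right (K n x z)).sub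
        (hK.hasSum_urnPi_mul h0 h1 n z)).mul_left (s z)
  have hr := (((hasSum_urnPi h0 h1).mul_right (lam ^ (-2 * x))).add
    (hasSum_urnPi_mul_zpow h0 h1)).mul_left (2 * lam / (1 - lam ^ 2) * (lam ^ 2) ^ n)
  have := hasSum_le (fun y => ?_) hl hr
  · simpa [s, sign_mul_self] using this
  · calc ∑ z ∈ S, s z * (urnPi lam y * (K n x z - K n y z))
        ≤ ∑ z ∈ S, urnPi lam y * |K n x z - K n y z| := by
          refine Finset.sum_le_sum fun z _ => (le_abs_self _).trans ?_
          rw [abs_mul, abs_mul, abs_of_nonneg (urnPi_nonneg h0 y)]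
          exact mul_le_of_le_one_left (mul_nonneg (urnPi_nonneg h0 y) (abs_nonneg _)) (hs z)
      _ ≤ urnPi lam y * (2 * lam / (1 - lam ^ 2) * (lam ^ 2) ^ n *
            (lam ^ (-2 * x) + lam ^ (-2 * y))) := by
          rw [← Finset.mul_sum]
          exact mul_le_mul_of_nonneg_left (hK.sum_abs_sub_le h0 h1 S hn x y) (urnPi_nonneg h0 y)
      _ = _ := by ring

end IsDownStepKernel
end Transition

section Path

/-- The path that starts at `x` and then follows `ω`. -/
def pathCons (x : ℤ) (ω : ℕ → ℤ) : ℕ → ℤ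
  | 0 => x
  | n + 1 => ω n

/-- At its `t`-th down-step (at time `0` if `t = 0`), the path `ω` is in state `k`. -/
def AtDownStep (ω : ℕ → ℤ) (t : ℕ) (k : ℤ) : Prop :=
  ∃ j, downCount ω j = t ∧ (∀ j' < j, downCount ω j' ≠ t) ∧ ω j = k

lemma downCount_eq_sum (ω : ℕ → ℤ) (j : ℕ) :
    downCount ω j = ∑ ℓ ∈ Finset.range j, if ω (ℓ + 1) = ω ℓ - 1 then 1 else 0 := by
  unfold downCount
  rw [Finset.card_filter, Finset.range_eq_Ico]
  exact (Finset.sum_Ico_add' (fun ℓ => if ω ℓ = ω (ℓ - 1) - 1 then 1 else 0) 0 j 1).symm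

@[simp] lemma downCount_zero (ω : ℕ → ℤ) : downCount ω 0 = 0 := rfl

lemma downCount_pathCons (x : ℤ) (ω : ℕ → ℤ) (j : ℕ) :
    downCount (pathCons x ω) (j + 1) = downCount ω j + if ω 0 = x - 1 then 1 else 0 := by
  simp only [downCount_eq_sum, Finset.sum_range_succ' _ j]
  rfl

lemma exists_downCount_pathCons (x : ℤ) (ω : ℕ → ℤ) (t : ℕ) :
    (∃ j, downCount (pathCons x ω) j = t + 1) ↔
      ∃ j, downCount ω j = if ω 0 = x - 1 then t else t + 1 := by
  have hiff : ∀ j, downCount (pathCons x ω) (j + 1) = t + 1 ↔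
      downCount ω j = if ω 0 = x - 1 then t else t + 1 := fun j => by
    rw [downCount_pathCons]; split_ifs <;> simp
  constructor
  · rintro ⟨_ | j, hj⟩
    · simp at hj
    · exact ⟨j, (hiff j).1 hj⟩
  · rintro ⟨j, hj⟩
    exact ⟨j + 1, (hiff j).2 hj⟩

lemma atDownStep_pathCons (x : ℤ) (ω : ℕ → ℤ) (t : ℕ) (k : ℤ) :
    AtDownStep (pathCons x ω) (t + 1) k ↔
      AtDownStep ω (if ω 0 = x - 1 then t else t + 1) k := by
  have hiff : ∀ j, downCount (pathCons x ω) (j + 1) = t + 1 ↔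
      downCount ω j = if ω 0 = x - 1 then t else t + 1 := fun j => by
    rw [downCount_pathCons]; split_ifs <;> simp
  constructor
  · rintro ⟨_ | j, hj, hmin, hk⟩
    · simp at hj
    · exact ⟨j, (hiff j).1 hj, fun j' hj' h => hmin (j' + 1) (by lia) ((hiff j').2 h), hk⟩
  · rintro ⟨j, hj, hmin, hk⟩
    refine ⟨j + 1, (hiff j).2 hj, ?_, hk⟩
    rintro (_ | j') hj' h
    · simp at h
    · exact hmin j' (by lia) ((hiff j').1 h)

lemma atDownStep_zero (ω : ℕ → ℤ) (k : ℤ) : AtDownStep ω 0 k ↔ ω 0 = k := by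
  constructor
  · rintro ⟨_ | j, _, hmin, hk⟩
    · exact hk
    · exact absurd rfl (hmin 0 (by lia))
  · exact fun h => ⟨0, rfl, by simp, h⟩

lemma AtDownStep.unique {ω : ℕ → ℤ} {t : ℕ} {k k' : ℤ} (h : AtDownStep ω t k)
    (h' : AtDownStep ω t k') : k = k' := by
  obtain ⟨j, hj, hmin, rfl⟩ := h
  obtain ⟨j', hj', hmin', rfl⟩ := h'
  rcases lt_trichotomy j j' with hlt | rfl | hlt
  · exact absurd hj (hmin' j hlt)
  · rfl
  · exact absurd hj' (hmin j' hlt)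

lemma atDownStep_iff_betaTime {ω : ℕ → ℤ} {t : ℕ} (ht : 0 < t) (h : ∃ j, downCount ω j = t)
    (k : ℤ) : AtDownStep ω t k ↔ ω (betaTime ω t) = k := by
  have hpos : ∀ j, downCount ω j = t → 1 ≤ j := by
    rintro (_ | j) hj
    · simp at hj; lia
    · lia
  have hne : {j | 1 ≤ j ∧ downCount ω j = t}.Nonempty := by
    obtain ⟨j, hj⟩ := h
    exact ⟨j, hpos j hj, hj⟩
  have hmem : downCount ω (betaTime ω t) = t := (Nat.sInf_mem hne).2
  have hle : ∀ j, downCount ω j = t → betaTime ω t ≤ j := fun j hj =>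
    Nat.sInf_le ⟨hpos j hj, hj⟩
  constructor
  · rintro ⟨j, hj, hmin, rfl⟩
    rcases (hle j hj).lt_or_eq with h' | h'
    · exact absurd hmem (hmin _ h')
    · rw [h']
  · exact fun hk => ⟨_, hmem, fun j' hj' h' => absurd (hle j' h') (by lia), hk⟩

lemma measurableSet_apply_eq (j : ℕ) (k : ℤ) : MeasurableSet {ω : ℕ → ℤ | ω j = k} :=
  measurableSet_eq_fun (measurable_pi_apply j) measurable_const

lemma measurable_pathCons (x : ℤ) : Measurable (pathCons x) :=
  measurable_pi_lambda _ fun n => by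
    cases n with
    | zero => exact measurable_const
    | succ n => exact measurable_pi_apply n

lemma measurable_downCount (j : ℕ) : Measurable fun ω => downCount ω j := by
  simp only [downCount_eq_sum]
  refine Finset.measurable_sum _ fun ℓ _ => Measurable.ite ?_ measurable_const measurable_const
  exact measurableSet_eq_fun (measurable_pi_apply _) ((measurable_pi_apply _).sub_const 1)

lemma measurableSet_downCount_eq (j t : ℕ) : MeasurableSet {ω | downCount ω j = t} :=
  measurable_downCount j (measurableSet_singleton t)

lemma measurableSet_atDownStep (t : ℕ) (k : ℤ) : MeasurableSet {ω | AtDownStep ω t k} := by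
  simp only [AtDownStep, Set.ofPred_exists, Set.ofPred_and, Set.ofPred_forall]
  exact .iUnion fun j => (measurableSet_downCount_eq j t).inter <|
    (MeasurableSet.iInter fun j' => .iInter fun _ => (measurableSet_downCount_eq j' t).compl).inter
      (measurableSet_apply_eq j k)

lemma measurableSet_forall_atDownStep {N : ℕ} (t : Fin N → ℕ) (k : Fin N → ℤ) :
    MeasurableSet {ω | ∀ i, AtDownStep ω (t i) (k i)} := by
  rw [Set.ofPred_forall]
  exact .iInter fun i => measurableSet_atDownStep _ _

lemma measurableSet_cylinder_le (n : ℕ) (p : ℕ → ℤ) :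
    MeasurableSet {ω : ℕ → ℤ | ∀ i ≤ n, ω i = p i} := by
  simp only [Set.ofPred_forall]
  exact .iInter fun i => .iInter fun _ => measurableSet_apply_eq i (p i)

/-- A probability measure on integer sequences is determined by its cylinder probabilities. -/
lemma ext_of_cylinder_le {μ ν : Measure (ℕ → ℤ)} [IsProbabilityMeasure μ]
    [IsProbabilityMeasure ν]
    (h : ∀ (n : ℕ) (p : ℕ → ℤ), μ {ω | ∀ i ≤ n, ω i = p i} = ν {ω | ∀ i ≤ n, ω i = p i}) : μ = ν := by
  set C : Set (Set (ℕ → ℤ)) := {s | ∃ (n : ℕ) (p : ℕ → ℤ), s = {ω | ∀ i ≤ n, ω i = p i}}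
  refine ext_of_generate_finite C (le_antisymm ?_ ?_) ?_ ?_ (by simp)
  · refine iSup_le fun i => Measurable.comap_le (m₁ := .generateFrom C) ?_
    refine @measurable_to_countable' _ _ _ _ (.generateFrom C) _ fun a => ?_
    have : (fun ω : ℕ → ℤ => ω i) ⁻¹' {a} = ⋃ p : {p : Fin (i + 1) → ℤ // p (Fin.last i) = a},
        {ω | ∀ j ≤ i, ω j = if h : j < i + 1 then p.1 ⟨j, h⟩ else 0} := by
      ext ω
      simp only [Set.mem_preimage, Set.mem_singleton_iff, Set.mem_iUnion, Set.mem_ofPred_eq]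
      constructor
      · intro hω
        refine ⟨⟨fun j => ω j, hω⟩, fun j hj => ?_⟩
        simp [Nat.lt_succ_of_le hj]
      · rintro ⟨⟨p, hp⟩, hω⟩
        exact (hω i le_rfl).trans ((dif_pos i.lt_succ_self).trans hp)
    rw [this]
    exact .iUnion fun p => MeasurableSpace.measurableSet_generateFrom ⟨i, _, rfl⟩
  · refine MeasurableSpace.generateFrom_le ?_
    rintro _ ⟨n, p, rfl⟩
    exact measurableSet_cylinder_le n p
  · rintro _ ⟨n, p, rfl⟩ _ ⟨m, q, rfl⟩ ⟨ω, hp, hq⟩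
    refine ⟨max n m, ω, ?_⟩
    ext ω'
    simp only [Set.mem_inter_iff, Set.mem_ofPred_eq] at hp hq ⊢
    constructor
    · rintro ⟨h1, h2⟩ i hi
      rcases le_max_iff.1 hi with h' | h'
      · rw [h1 i h', hp i h']
      · rw [h2 i h', hq i h']
    · exact fun h' => ⟨fun i hi => by rw [h' i (le_max_of_le_left hi), hp i hi],
        fun i hi => by rw [h' i (le_max_of_le_right hi), hq i hi]⟩
  · rintro _ ⟨n, p, rfl⟩
    exact h n p

end Path

namespace IsUrnChain

variable {lam : ℝ} {P : ℤ → Measure (ℕ → ℤ)}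

lemma real_cylinder (hP : IsUrnChain lam P) (x : ℤ) (n : ℕ) (p : ℕ → ℤ) :
    (P x).real {ω | ∀ i ≤ n, ω i = p i} =
      (if p 0 = x then (1 : ℝ) else 0) * ∏ i ∈ Finset.range n, urnStep lam (p i) (p (i + 1)) :=
  hP.2 x n p

lemma real_start (hP : IsUrnChain lam P) (x z : ℤ) :
    (P x).real {ω | ω 0 = z} = if x = z then 1 else 0 := by
  simpa [eq_comm] using hP.real_cylinder x 0 fun _ => z

lemma ae_start (hP : IsUrnChain lam P) (x : ℤ) : ∀ᵐ ω ∂P x, ω 0 = x := by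
  have := hP.1 x
  have h := hP.real_start x x
  rw [if_pos rfl, measureReal_def, ENNReal.toReal_eq_one_iff] at h
  exact (prob_compl_eq_zero_iff (measurableSet_apply_eq 0 x)).2 h

lemma real_pathCons_cylinder (hP : IsUrnChain lam P) (x y : ℤ) (n : ℕ) (p : ℕ → ℤ) :
    (P y).real (pathCons x ⁻¹' {ω | ∀ i ≤ n + 1, ω i = p i}) =
      if p 0 = x ∧ p 1 = y then ∏ i ∈ Finset.range n, urnStep lam (p (i + 1)) (p (i + 2))
      else 0 := by
  have hset : pathCons x ⁻¹' {ω | ∀ i ≤ n + 1, ω i = p i} =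
      {ω | p 0 = x ∧ ∀ i ≤ n, ω i = p (i + 1)} := by
    ext ω
    simp only [Set.mem_preimage, Set.mem_ofPred_eq]
    constructor
    · exact fun h => ⟨(h 0 (by lia)).symm, fun i hi => h (i + 1) (by lia)⟩
    · rintro ⟨h, h'⟩ (_ | i) hi
      · exact h.symm
      · exact h' i (by lia)
  rw [hset]
  by_cases h : p 0 = x
  · simpa [h] using hP.real_cylinder y n fun i => p (i + 1)
  · simp [h]

/-- First-step decomposition of the law of the chain. -/
lemma eq_add_map_pathCons (hP : IsUrnChain lam P) (h0 : 0 < lam) (x : ℤ) :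
    P x = ENNReal.ofReal (downProb lam x) • (P (x - 1)).map (pathCons x) +
      ENNReal.ofReal (upProb lam x) • (P (x + 1)).map (pathCons x) := by
  have := hP.1
  have hm := measurable_pathCons x
  have hd := downProb_nonneg h0 x
  have hu := upProb_nonneg h0 x
  have : IsProbabilityMeasure
      (ENNReal.ofReal (downProb lam x) • (P (x - 1)).map (pathCons x) +
        ENNReal.ofReal (upProb lam x) • (P (x + 1)).map (pathCons x)) := by
    refine ⟨?_⟩
    simp [Measure.map_apply hm, ← ENNReal.ofReal_add hd hu, downProb_add_upProb h0]
  refine ext_of_cylinder_le fun n p => ?_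
  rw [← ENNReal.toReal_eq_toReal_iff' (measure_ne_top _ _) (measure_ne_top _ _)]
  rw [hP.2, Measure.add_apply, Measure.smul_apply, Measure.smul_apply,
    Measure.map_apply hm (measurableSet_cylinder_le n p),
    Measure.map_apply hm (measurableSet_cylinder_le n p),
    smul_eq_mul, smul_eq_mul, ENNReal.toReal_add (by finiteness) (by finiteness),
    ENNReal.toReal_mul, ENNReal.toReal_mul, ENNReal.toReal_ofReal hd, ENNReal.toReal_ofReal hu]
  rw [← measureReal_def, ← measureReal_def]
  cases n with
  | zero =>
    by_cases h : x = p 0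
    · subst h
      simp [pathCons, downProb_add_upProb h0]
    · simp [pathCons, h, Ne.symm h]
  | succ n =>
    rw [hP.real_pathCons_cylinder, hP.real_pathCons_cylinder, Finset.prod_range_succ']
    by_cases h : p 0 = x
    · subst h
      have h2 : p 0 + 1 ≠ p 0 - 1 := by lia
      by_cases h3 : p 1 = p 0 + 1
      · simp [h3, h2, urnStep, upProb, mul_comm]
      · by_cases h4 : p 1 = p 0 - 1
        · simp [h4, h2.symm, urnStep, downProb, mul_comm]
        · simp [h3, h4, urnStep]
    · simp [h]

lemma real_eq_add (hP : IsUrnChain lam P) (h0 : 0 < lam) (x : ℤ) {A D U : Set (ℕ → ℤ)}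
    (hA : MeasurableSet A) (hD : ∀ ω, ω 0 = x - 1 → (pathCons x ω ∈ A ↔ ω ∈ D))
    (hU : ∀ ω, ω 0 ≠ x - 1 → (pathCons x ω ∈ A ↔ ω ∈ U)) :
    (P x).real A = downProb lam x * (P (x - 1)).real D + upProb lam x * (P (x + 1)).real U := by
  have := hP.1
  have hm := measurable_pathCons x
  have e1 : P (x - 1) (pathCons x ⁻¹' A) = P (x - 1) D :=
    measure_congr <| (hP.ae_start (x - 1)).mono fun ω hω => propext (hD ω hω)
  have e2 : P (x + 1) (pathCons x ⁻¹' A) = P (x + 1) U :=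
    measure_congr <| (hP.ae_start (x + 1)).mono fun ω hω => propext (hU ω (by lia))
  rw [measureReal_def, hP.eq_add_map_pathCons h0 x, Measure.add_apply, Measure.smul_apply,
    Measure.smul_apply, Measure.map_apply hm hA, Measure.map_apply hm hA, e1, e2,
    smul_eq_mul, smul_eq_mul, ENNReal.toReal_add (by finiteness) (by finiteness),
    ENNReal.toReal_mul, ENNReal.toReal_mul, ENNReal.toReal_ofReal (downProb_nonneg h0 x),
    ENNReal.toReal_ofReal (upProb_nonneg h0 x)]
  rfl

/-- Almost surely, every down-step occurs. -/
lemma ae_exists_downCount (hP : IsUrnChain lam P) (h0 : 0 < lam) (h1 : lam < 1) (x : ℤ) :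
    ∀ᵐ ω ∂P x, ∀ t, ∃ j, downCount ω j = t := by
  have := hP.1
  rw [ae_all_iff]
  intro t
  have key : (P x).real {ω | ¬∃ j, downCount ω j = t} ≤ 0 := by
    induction t generalizing x with
    | zero =>
      have : {ω | ¬∃ j, downCount ω j = 0} = ∅ := by
        ext ω; simpa using ⟨0, downCount_zero ω⟩
      rw [this, measureReal_empty]
    | succ t ih =>
      refine nonpos_of_le_upProb_mul h0 h1
        (f := fun x => (P x).real {ω | ¬∃ j, downCount ω j = t + 1}) (B := 1)
        (fun y => measureReal_le_one) (fun y => ?_) x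
      have hmeas : MeasurableSet {ω | ¬∃ j, downCount ω j = t + 1} := by
        rw [← Set.compl_ofPred, Set.ofPred_exists]
        exact (MeasurableSet.iUnion fun j => measurableSet_downCount_eq j (t + 1)).compl
      rw [hP.real_eq_add h0 y (D := {ω | ¬∃ j, downCount ω j = t})
        (U := {ω | ¬∃ j, downCount ω j = t + 1}) hmeas
        (fun ω hω => by
          simp only [Set.mem_ofPred_eq, exists_downCount_pathCons, if_pos hω])
        (fun ω hω => by
          simp only [Set.mem_ofPred_eq, exists_downCount_pathCons, if_neg hω])]
      linarith [mul_nonpos_of_nonneg_of_nonpos (downProb_nonneg h0 y) (ih (y - 1))]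
  exact (measureReal_eq_zero_iff (by finiteness)).1 (le_antisymm key measureReal_nonneg)

lemma isDownStepKernel (hP : IsUrnChain lam P) (h0 : 0 < lam) :
    IsDownStepKernel lam fun n y z => (P y).real {ω | AtDownStep ω n z} where
  zero y z := by simpa [atDownStep_zero] using hP.real_start y z
  nonneg _ _ _ := measureReal_nonneg
  le_one _ y _ := by have := hP.1 y; exact measureReal_le_one
  succ n y z := hP.real_eq_add h0 y (measurableSet_atDownStep _ _)
    (fun ω hω => by simp only [Set.mem_ofPred_eq, atDownStep_pathCons, if_pos hω])
    (fun ω hω => by simp only [Set.mem_ofPred_eq, atDownStep_pathCons, if_neg hω])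

/-- Strong Markov property at the first observed down-step. -/
lemma real_forall_atDownStep_succ (hP : IsUrnChain lam P) (h0 : 0 < lam) (h1 : lam < 1) {N : ℕ}
    (t : Fin (N + 1) → ℕ) (ht : ∀ i : Fin N, t 0 ≤ t i.succ) (k : Fin (N + 1) → ℤ) (x : ℤ) :
    (P x).real {ω | ∀ i, AtDownStep ω (t i) (k i)} =
      (P x).real {ω | AtDownStep ω (t 0) (k 0)} *
        (P (k 0)).real {ω | ∀ i : Fin N, AtDownStep ω (t i.succ - t 0) (k i.succ)} := by
  have := hP.1
  induction hs : t 0 generalizing t x with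
  | zero =>
    simp only [Fin.forall_fin_succ (P := fun i => AtDownStep _ (t i) (k i)), hs, atDownStep_zero,
      tsub_zero, hP.real_start]
    split_ifs with h
    · subst h
      rw [one_mul]
      refine measureReal_congr <| (hP.ae_start (k 0)).mono fun ω hω => propext ?_
      exact and_iff_right hω
    · rw [zero_mul, ← measureReal_empty (μ := P x)]
      refine measureReal_congr <| (hP.ae_start x).mono fun ω hω => propext ?_
      change (_ ∧ _) ↔ False
      simp [hω, h]
  | succ s ih =>
    have hpos : ∀ i, t i = (t i - 1) + 1 := by
      refine Fin.cases (by lia) fun i => ?_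
      have := ht i
      lia
    have hK := hP.isDownStepKernel h0
    refine eq_of_eq_add_upProb_mul h0 h1
      (f := fun x => (P x).real {ω | ∀ i, AtDownStep ω (t i) (k i)})
      (g := fun x => (P x).real {ω | AtDownStep ω (s + 1) (k 0)} *
        (P (k 0)).real {ω | ∀ i : Fin N, AtDownStep ω (t i.succ - (s + 1)) (k i.succ)})
      (c := fun x => downProb lam x *
        (P (x - 1)).real {ω | ∀ i, AtDownStep ω (t i - 1) (k i)}) (B := 1)
      (fun y => ?_) (fun y => ?_) (fun y => ?_) (fun y => ?_) x
    · rw [abs_of_nonneg measureReal_nonneg]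
      exact measureReal_le_one
    · rw [abs_of_nonneg (by positivity)]
      exact mul_le_one₀ measureReal_le_one measureReal_nonneg measureReal_le_one
    · refine hP.real_eq_add h0 y (measurableSet_forall_atDownStep t k) (fun ω hω => ?_)
        (fun ω hω => ?_)
      · refine forall_congr' fun i => ?_
        rw [hpos i, atDownStep_pathCons, if_pos hω, Nat.add_sub_cancel]
      · refine forall_congr' fun i => ?_
        rw [hpos i, atDownStep_pathCons, if_neg hω]
    · have hIH := ih (fun i => t i - 1) (fun i => Nat.sub_le_sub_right (ht i) 1) (y - 1)
        (by simp [hs])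
      have hsub : ∀ i : Fin N, t i.succ - 1 - s = t i.succ - (s + 1) := fun i => by lia
      simp only [hsub] at hIH
      rw [hIH, hK.succ s y (k 0)]
      ring

lemma tsum_real_forall_atDownStep_le_one (hP : IsUrnChain lam P) {N : ℕ} (t : Fin N → ℕ)
    (x : ℤ) :
    ∑' k : Fin N → ℤ, ENNReal.ofReal ((P x).real {ω | ∀ i, AtDownStep ω (t i) (k i)}) ≤ 1 := by
  have := hP.1 x
  have hreal : ∀ k : Fin N → ℤ, ENNReal.ofReal ((P x).real {ω | ∀ i, AtDownStep ω (t i) (k i)}) =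
      P x {ω | ∀ i, AtDownStep ω (t i) (k i)} := fun _ => ofReal_measureReal
  simp only [hreal]
  refine (tsum_measure_le_measure_univ
    (fun k => (measurableSet_forall_atDownStep t k).nullMeasurableSet)
    (fun k k' hk => (Set.disjoint_left.2 fun ω h h' => hk ?_).aedisjoint)).trans_eq measure_univ
  exact funext fun i => (h i).unique (h' i)

lemma tsum_abs_sub_urnPi_le (hP : IsUrnChain lam P) (h0 : 0 < lam) (h1 : lam < 1) {n : ℕ}
    (hn : 0 < n) (x : ℤ) :
    ∑' z, ENNReal.ofReal |(P x).real {ω | AtDownStep ω n z} - urnPi lam z| ≤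
      ENNReal.ofReal (2 * lam / (1 - lam ^ 2) * (lam ^ (-2 * x) + lam⁻¹)) *
        ENNReal.ofReal (lam ^ 2) ^ n := by
  have h2 : 0 < 1 - lam ^ 2 := by nlinarith
  refine ENNReal.summable.tsum_le_of_sum_le fun S => ?_
  rw [← ENNReal.ofReal_sum_of_nonneg fun _ _ => abs_nonneg _,
    ← ENNReal.ofReal_pow (by positivity), ← ENNReal.ofReal_mul (by positivity)]
  exact ENNReal.ofReal_le_ofReal <|
    ((hP.isDownStepKernel h0).sum_abs_sub_urnPi_le h0 h1 S hn x).trans_eq (by ring)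

lemma tsum_abs_forall_atDownStep_le (hP : IsUrnChain lam P) (h0 : 0 < lam) (h1 : lam < 1)
    (N : ℕ) (n : ℕ → ℕ) (hn : ∀ i < N, n i < n (i + 1)) (x : ℤ) :
    ∑' k : Fin N → ℤ, ENNReal.ofReal
        |(P x).real {ω | ∀ i : Fin N, AtDownStep ω (n (i + 1) - n 0) (k i)} -
          ∏ i, urnPi lam (k i)| ≤
      ∑ i ∈ Finset.range N,
        ENNReal.ofReal (2 * lam / (1 - lam ^ 2) *
            ((if i = 0 then lam ^ (-2 * x) else lam⁻¹) + lam⁻¹)) *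
          ENNReal.ofReal (lam ^ 2) ^ (n (i + 1) - n i) := by
  have := hP.1
  have h2 : 0 < 1 - lam ^ 2 := by nlinarith
  induction N generalizing n x with
  | zero => simp
  | succ N ih =>
    have hmono : ∀ i ≤ N, n 1 ≤ n (i + 1) := fun i => by
      induction i with
      | zero => intro; rfl
      | succ i hi => exact fun h => (hi (by lia)).trans (hn (i + 1) (by lia)).le
    have h01 := hn 0 (by lia)
    have hfac : ∀ (a : ℤ) (k : Fin N → ℤ),
        (P x).real {ω | ∀ i : Fin (N + 1),
          AtDownStep ω (n (i + 1) - n 0) ((Fin.cons a k : Fin (N + 1) → ℤ) i)} =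
        (P x).real {ω | AtDownStep ω (n 1 - n 0) a} *
          (P a).real {ω | ∀ i : Fin N, AtDownStep ω (n (i + 1 + 1) - n (0 + 1)) (k i)} := by
      intro a k
      have hsub : ∀ i : Fin N,
          n (i + 1 + 1) - n 0 - (n (0 + 1) - n 0) = n (i + 1 + 1) - n (0 + 1) := fun i => by
        have := hmono (i + 1) (by lia)
        simp only [zero_add]
        lia
      have := hP.real_forall_atDownStep_succ h0 h1 (fun i : Fin (N + 1) => n (i + 1) - n 0)
        (fun i => Nat.sub_le_sub_right (by simpa using hmono (i + 1) (by lia)) _)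
        (Fin.cons a k) x
      simpa [hsub] using this
    rw [← (Fin.consEquiv fun _ : Fin (N + 1) => ℤ).tsum_eq, ENNReal.tsum_prod']
    have hterm : ∀ a : ℤ, ∑' k : Fin N → ℤ, ENNReal.ofReal
        |(P x).real {ω | ∀ i : Fin (N + 1),
          AtDownStep ω (n (i + 1) - n 0) ((Fin.cons a k : Fin (N + 1) → ℤ) i)} -
          ∏ i, urnPi lam ((Fin.cons a k : Fin (N + 1) → ℤ) i)| ≤
        ENNReal.ofReal |(P x).real {ω | AtDownStep ω (n 1 - n 0) a} - urnPi lam a| +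
          ENNReal.ofReal (urnPi lam a) * ∑ i ∈ Finset.range N,
            ENNReal.ofReal (2 * lam / (1 - lam ^ 2) *
              ((if i = 0 then lam ^ (-2 * a) else lam⁻¹) + lam⁻¹)) *
            ENNReal.ofReal (lam ^ 2) ^ (n (i + 1 + 1) - n (i + 1)) := by
      intro a
      have hπ := urnPi_nonneg h0 a
      set q := (P x).real {ω | AtDownStep ω (n 1 - n 0) a}
      set J : (Fin N → ℤ) → ℝ := fun k =>
        (P a).real {ω | ∀ i : Fin N, AtDownStep ω (n (i + 1 + 1) - n (0 + 1)) (k i)}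
      have hJ : ∀ k, 0 ≤ J k := fun _ => measureReal_nonneg
      calc _ ≤ ∑' k, (ENNReal.ofReal |q - urnPi lam a| * ENNReal.ofReal (J k) +
            ENNReal.ofReal (urnPi lam a) * ENNReal.ofReal |J k - ∏ i, urnPi lam (k i)|) := by
            refine ENNReal.tsum_le_tsum fun k => ?_
            rw [hfac, Fin.prod_univ_succ, ← ENNReal.ofReal_mul (abs_nonneg _),
              ← ENNReal.ofReal_mul hπ,
              ← ENNReal.ofReal_add (mul_nonneg (abs_nonneg _) (hJ k)) (by positivity)]
            refine ENNReal.ofReal_le_ofReal ?_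
            simp only [Fin.cons_zero, Fin.cons_succ]
            calc |q * J k - urnPi lam a * ∏ i, urnPi lam (k i)|
                = |(q - urnPi lam a) * J k + urnPi lam a * (J k - ∏ i, urnPi lam (k i))| := by
                  ring_nf
              _ ≤ _ := by
                  refine (abs_add_le _ _).trans_eq ?_
                  rw [abs_mul, abs_mul, abs_of_nonneg (hJ k), abs_of_nonneg hπ]
        _ ≤ _ := by
            rw [ENNReal.tsum_add, ENNReal.tsum_mul_left, ENNReal.tsum_mul_left]
            refine add_le_add (mul_le_of_le_one_right' ?_) (mul_le_mul_right ?_ _)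
            · exact hP.tsum_real_forall_atDownStep_le_one _ a
            · exact ih (fun i => n (i + 1)) (fun i hi => hn (i + 1) (by lia)) a
    refine (ENNReal.tsum_le_tsum hterm).trans ?_
    rw [ENNReal.tsum_add, Finset.sum_range_succ', add_comm]
    refine add_le_add ?_ ?_
    · simp only [Finset.mul_sum]
      rw [Summable.tsum_finsetSum fun _ _ => ENNReal.summable]
      refine Finset.sum_le_sum fun i _ => ?_
      simp only [← mul_assoc, ENNReal.tsum_mul_right]
      refine mul_le_mul_left (le_of_eq ?_) _
      have hs : HasSum (fun a => urnPi lam a * (2 * lam / (1 - lam ^ 2) *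
          ((if i = 0 then lam ^ (-2 * a) else lam⁻¹) + lam⁻¹)))
          (2 * lam / (1 - lam ^ 2) * (lam⁻¹ + lam⁻¹)) := by
        have hc := (hasSum_urnPi h0 h1).mul_right lam⁻¹
        rw [one_mul] at hc
        have hi : HasSum (fun a => urnPi lam a * if i = 0 then lam ^ (-2 * a) else lam⁻¹)
            lam⁻¹ := by
          split_ifs
          · exact hasSum_urnPi_mul_zpow h0 h1
          · exact hc
        exact ((hi.add hc).mul_left (2 * lam / (1 - lam ^ 2))).congr_fun fun a => by ring
      simp only [← ENNReal.ofReal_mul (urnPi_nonneg h0 _)]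
      rw [← ENNReal.ofReal_tsum_of_nonneg _ hs.summable, hs.tsum_eq]
      · simp
      · intro a
        have := urnPi_nonneg h0 a
        split_ifs <;> positivity
    · simpa using hP.tsum_abs_sub_urnPi_le h0 h1 (Nat.sub_pos_of_lt h01) x

end IsUrnChain

/-- Joint exponential convergence of `(𝔇_{β_{n₁}},…,𝔇_{β_{n_N}})` to `π^{⊗N}` in total
variation, uniformly in the starting point `x ∈ {0,1}`. -/
theorem urn_joint_tv_bound (lam : ℝ) (hlam : lam ∈ Set.Ioo (0 : ℝ) 1)
    (P : ℤ → Measure (ℕ → ℤ)) (hP : IsUrnChain lam P) :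
    ∃ C₂ > (0 : ℝ), ∃ C₃ > (0 : ℝ),
      ∀ (N : ℕ) (n : ℕ → ℕ), n 0 = 0 → (∀ i < N, n i < n (i + 1)) →
        ∀ x : ℤ, x = 0 ∨ x = 1 →
        ∑' k : Fin N → ℤ,
            ENNReal.ofReal
              |(P x {ω | ∀ i : Fin N, ω (betaTime ω (n (i.1 + 1))) = k i}).toReal -
                ∏ i : Fin N, urnPi lam (k i)| ≤
          ENNReal.ofReal
            (C₃ * ∑ i ∈ Finset.range N, Real.exp (-C₂ * ((n (i + 1) : ℝ) - (n i : ℝ)))) := by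
  obtain ⟨h0, h1⟩ := hlam
  have h2 : 0 < 1 - lam ^ 2 := by nlinarith
  have hlog := Real.log_neg h0 h1
  refine ⟨-(2 * Real.log lam), by linarith,
    2 * lam / (1 - lam ^ 2) * (lam⁻¹ ^ 2 + lam⁻¹ ^ 2), by positivity, ?_⟩
  intro N n hn0 hn x hx
  have hevent : ∀ k : Fin N → ℤ,
      (P x {ω | ∀ i : Fin N, ω (betaTime ω (n (i.1 + 1))) = k i}).toReal =
        (P x).real {ω | ∀ i : Fin N, AtDownStep ω (n (i + 1) - n 0) (k i)} := fun k => by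
    refine measureReal_congr ((hP.ae_exists_downCount h0 h1 x).mono fun ω hω => propext ?_)
    refine forall_congr' fun i => ?_
    rw [hn0, Nat.sub_zero]
    exact (atDownStep_iff_betaTime (Nat.zero_lt_of_lt (hn i i.2)) (hω _) _).symm
  simp only [hevent]
  refine (hP.tsum_abs_forall_atDownStep_le h0 h1 N n hn x).trans ?_
  rw [Finset.mul_sum, ENNReal.ofReal_sum_of_nonneg fun _ _ => by positivity]
  refine Finset.sum_le_sum fun i hi => ?_
  have hexp : Real.exp (-(-(2 * Real.log lam)) * ((n (i + 1) : ℝ) - (n i : ℝ))) =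
      (lam ^ 2) ^ (n (i + 1) - n i) := by
    rw [← Nat.cast_sub (hn i (Finset.mem_range.1 hi)).le, ← Real.exp_log (pow_pos h0 2),
      ← Real.exp_nat_mul, Real.log_pow]
    congr 1
    push_cast
    ring
  have hinv : 1 ≤ lam⁻¹ := (one_le_inv₀ h0).2 h1.le
  have hinv2 : lam⁻¹ ≤ lam⁻¹ ^ 2 := le_self_pow₀ hinv two_ne_zero
  rw [hexp, ← ENNReal.ofReal_pow (by positivity),
    ENNReal.ofReal_mul (q := (lam ^ 2) ^ (n (i + 1) - n i)) (by positivity)]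
  refine mul_le_mul_left (ENNReal.ofReal_le_ofReal ?_) _
  refine mul_le_mul_of_nonneg_left (add_le_add ?_ hinv2) (by positivity)
  split_ifs
  · rcases hx with rfl | rfl
    · simpa using hinv.trans hinv2
    · exact (by simp [zpow_neg] : lam ^ (-2 * (1 : ℤ)) = lam⁻¹ ^ 2).le
  · exact hinv2
end
end

section
/- For all integers x, y with y ≥ x − 1, P_x(𝔇_{β₁} = y + 1) = (λ^{2y+1}/(1 + λ^{2y+3})) · P_x(𝔇_{β₁} = y). In particular the ratio P_x(𝔇_{β₁} = y+1)/P_x(𝔇_{β₁} = y) does not depend on x. -/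
open MeasureTheory Filter ProbabilityTheory

noncomputable section

/-- The path climbs one unit per step during the first `n` steps from `x`. -/
def climbSet (x : ℤ) (n : ℕ) : Set (ℕ → ℤ) := {ω | ∀ i ≤ n, ω i = x + i}

/-- The path from `x` makes its first `k` steps upwards and its next step downwards. -/
def firstDropSet (x : ℤ) (k : ℕ) : Set (ℕ → ℤ) := climbSet x k ∩ {ω | ω (k + 1) = x + k - 1}

lemma measurableSet_climbSet (x : ℤ) (n : ℕ) : MeasurableSet (climbSet x n) := by
  have : climbSet x n = ⋂ i, ⋂ (_ : i ≤ n), (fun ω : ℕ → ℤ => ω i) ⁻¹' {x + (i : ℤ)} := by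
    ext ω; simp [climbSet]
  rw [this]
  exact MeasurableSet.iInter fun i => MeasurableSet.iInter fun _ =>
    measurable_pi_apply i (measurableSet_singleton _)

lemma measurableSet_firstDropSet (x : ℤ) (k : ℕ) : MeasurableSet (firstDropSet x k) :=
  (measurableSet_climbSet x k).inter (measurable_pi_apply (k + 1) (measurableSet_singleton _))

lemma betaTime_one_of_mem_firstDropSet {x : ℤ} {k : ℕ} {ω : ℕ → ℤ} (h : ω ∈ firstDropSet x k) :
    betaTime ω 1 = k + 1 := by
  obtain ⟨hup, hdown⟩ := h
  simp only [climbSet, Set.mem_ofPred_eq] at hup hdown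
  have hno : ∀ l, 1 ≤ l → l ≤ k → ω l ≠ ω (l - 1) - 1 := by
    intro l h1 h2
    rw [hup l h2, hup (l - 1) (by omega)]
    omega
  have hzero : ∀ j ≤ k, downCount ω j = 0 := by
    intro j hj
    rw [downCount, Finset.card_eq_zero, Finset.filter_eq_empty_iff]
    intro l hl
    rw [Finset.mem_Icc] at hl
    exact hno l hl.1 (hl.2.trans hj)
  have hone : downCount ω (k + 1) = 1 := by
    rw [downCount, Finset.card_eq_one]
    refine ⟨k + 1, ?_⟩
    ext l
    simp only [Finset.mem_filter, Finset.mem_Icc, Finset.mem_singleton]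
    constructor
    · rintro ⟨⟨h1, h2⟩, h3⟩
      by_contra hne
      exact hno l h1 (by omega) h3
    · rintro rfl
      refine ⟨⟨by omega, le_rfl⟩, ?_⟩
      rw [hdown, Nat.add_sub_cancel, hup k le_rfl]
  refine le_antisymm (Nat.sInf_le ⟨by omega, hone⟩) ?_
  refine le_csInf ⟨k + 1, by omega, hone⟩ ?_
  rintro j ⟨-, hj⟩
  by_contra hlt
  have := hzero j (by omega)
  omega

lemma apply_betaTime_one_of_mem_firstDropSet {x : ℤ} {k : ℕ} {ω : ℕ → ℤ}
    (h : ω ∈ firstDropSet x k) : ω (betaTime ω 1) = x + k - 1 := by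
  rw [betaTime_one_of_mem_firstDropSet h]
  exact h.2

lemma urnStep_succ (lam : ℝ) (i : ℤ) :
    urnStep lam i (i + 1) = lam ^ (2 * i - 1) / (1 + lam ^ (2 * i - 1)) := by
  simp [urnStep]

lemma urnStep_pred (lam : ℝ) (i : ℤ) :
    urnStep lam i (i - 1) = 1 / (1 + lam ^ (2 * i - 1)) := by
  rw [urnStep, if_neg (by omega), if_pos rfl]

lemma urnStep_succ_add_pred {lam : ℝ} (hlam : 0 < lam) (i : ℤ) :
    urnStep lam i (i + 1) + urnStep lam i (i - 1) = 1 := by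
  rw [urnStep_succ, urnStep_pred]
  have := zpow_pos hlam (2 * i - 1)
  field_simp
  ring

lemma urnStep_succ_nonneg {lam : ℝ} (hlam : 0 < lam) (i : ℤ) : 0 ≤ urnStep lam i (i + 1) := by
  rw [urnStep_succ]
  have := zpow_pos hlam (2 * i - 1)
  positivity

lemma urnStep_succ_anti {lam : ℝ} (hlam : lam ∈ Set.Ioo (0 : ℝ) 1) {i j : ℤ} (hij : i ≤ j) :
    urnStep lam j (j + 1) ≤ urnStep lam i (i + 1) := by
  rw [urnStep_succ, urnStep_succ]
  have hi := zpow_pos hlam.1 (2 * i - 1)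
  have hj := zpow_pos hlam.1 (2 * j - 1)
  have hle : lam ^ (2 * j - 1) ≤ lam ^ (2 * i - 1) :=
    zpow_le_zpow_right_of_le_one₀ hlam.1 hlam.2.le (by omega)
  rw [div_le_div_iff₀ (by positivity) (by positivity)]
  nlinarith

lemma IsUrnChain.measureReal_climbSet {lam : ℝ} {P : ℤ → Measure (ℕ → ℤ)} (hP : IsUrnChain lam P)
    (x : ℤ) (n : ℕ) :
    (P x).real (climbSet x n) = ∏ i ∈ Finset.range n, urnStep lam (x + i) (x + i + 1) := by
  have h := hP.2 x n fun i => x + i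
  simp only [Nat.cast_zero, add_zero, if_true, one_mul, Nat.cast_add, Nat.cast_one,
    ← add_assoc] at h
  exact h

lemma IsUrnChain.measureReal_firstDropSet {lam : ℝ} {P : ℤ → Measure (ℕ → ℤ)}
    (hP : IsUrnChain lam P) (x : ℤ) (k : ℕ) :
    (P x).real (firstDropSet x k) =
      (P x).real (climbSet x k) * urnStep lam (x + k) (x + k - 1) := by
  have h := hP.2 x (k + 1) fun i => if i ≤ k then x + i else x + k - 1
  have hset : {ω : ℕ → ℤ | ∀ i ≤ k + 1, ω i = if i ≤ k then x + i else x + k - 1} =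
      firstDropSet x k := by
    ext ω
    simp only [firstDropSet, climbSet, Set.mem_ofPred_eq, Set.mem_inter_iff]
    constructor
    · intro hω
      refine ⟨fun i hi => ?_, ?_⟩
      · rw [hω i (by omega), if_pos hi]
      · rw [hω (k + 1) le_rfl, if_neg (by omega)]
    · rintro ⟨hup, hdown⟩ i hi
      split_ifs with hik
      · exact hup i hik
      · obtain rfl : i = k + 1 := by omega
        exact hdown
  rw [hset, Finset.prod_range_succ] at h
  rw [measureReal_def, h, hP.measureReal_climbSet]
  have hprod : ∀ i ∈ Finset.range k,
      urnStep lam (if i ≤ k then x + i else x + k - 1)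
        (if i + 1 ≤ k then x + (i + 1 : ℕ) else x + k - 1) =
      urnStep lam (x + i) (x + i + 1) := by
    intro i hi
    rw [Finset.mem_range] at hi
    rw [if_pos hi.le, if_pos (by omega), Nat.cast_succ, add_assoc]
  rw [Finset.prod_congr rfl hprod]
  simp

lemma climbSet_succ_subset (x : ℤ) (k : ℕ) : climbSet x (k + 1) ⊆ climbSet x k :=
  fun _ h i hi => h i (by omega)

lemma disjoint_climbSet_succ_firstDropSet (x : ℤ) (k : ℕ) :
    Disjoint (climbSet x (k + 1)) (firstDropSet x k) := by
  rw [Set.disjoint_left]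
  rintro ω h ⟨-, h'⟩
  have := h (k + 1) le_rfl
  simp only [Set.mem_ofPred_eq] at h'
  push_cast at this
  omega

lemma IsUrnChain.measure_climbSet_diff {lam : ℝ} (hlam : 0 < lam) {P : ℤ → Measure (ℕ → ℤ)}
    (hP : IsUrnChain lam P) (x : ℤ) (k : ℕ) :
    P x (climbSet x k \ (climbSet x (k + 1) ∪ firstDropSet x k)) = 0 := by
  have := hP.1 x
  have hsub : climbSet x (k + 1) ∪ firstDropSet x k ⊆ climbSet x k :=
    Set.union_subset (climbSet_succ_subset x k) Set.inter_subset_left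
  rw [← measureReal_eq_zero_iff, measureReal_sdiff hsub
    ((measurableSet_climbSet x _).union (measurableSet_firstDropSet x k)),
    measureReal_union (disjoint_climbSet_succ_firstDropSet x k) (measurableSet_firstDropSet x k),
    hP.measureReal_firstDropSet, hP.measureReal_climbSet x (k + 1), Finset.prod_range_succ,
    ← hP.measureReal_climbSet, ← mul_add, urnStep_succ_add_pred hlam]
  ring

lemma IsUrnChain.measure_iInter_climbSet {lam : ℝ} (hlam : lam ∈ Set.Ioo (0 : ℝ) 1)
    {P : ℤ → Measure (ℕ → ℤ)} (hP : IsUrnChain lam P) (x : ℤ) :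
    P x (⋂ n, climbSet x n) = 0 := by
  have := hP.1 x
  rw [← measureReal_eq_zero_iff]
  have hlt : urnStep lam x (x + 1) < 1 := by
    rw [urnStep_succ]
    have := zpow_pos hlam.1 (2 * x - 1)
    rw [div_lt_one (by positivity)]
    linarith
  have hbound : ∀ n : ℕ, (P x).real (⋂ n, climbSet x n) ≤ urnStep lam x (x + 1) ^ n := by
    intro n
    calc (P x).real (⋂ n, climbSet x n) ≤ (P x).real (climbSet x n) :=
          measureReal_mono (Set.iInter_subset _ n)
      _ = ∏ i ∈ Finset.range n, urnStep lam (x + i) (x + i + 1) := hP.measureReal_climbSet x n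
      _ ≤ ∏ _i ∈ Finset.range n, urnStep lam x (x + 1) :=
          Finset.prod_le_prod (fun i _ => urnStep_succ_nonneg hlam.1 _)
            fun i _ => urnStep_succ_anti hlam (by omega)
      _ = urnStep lam x (x + 1) ^ n := by simp
  exact le_antisymm (ge_of_tendsto' (tendsto_pow_atTop_nhds_zero_of_lt_one
    (urnStep_succ_nonneg hlam.1 x) hlt) hbound) measureReal_nonneg

lemma IsUrnChain.ae_exists_mem_firstDropSet {lam : ℝ} (hlam : lam ∈ Set.Ioo (0 : ℝ) 1)
    {P : ℤ → Measure (ℕ → ℤ)} (hP : IsUrnChain lam P) (x : ℤ) :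
    ∀ᵐ ω ∂P x, ∃ k, ω ∈ firstDropSet x k := by
  have := hP.1 x
  have hstart : ∀ᵐ ω ∂P x, ω ∈ climbSet x 0 := by
    refine (mem_ae_iff_prob_eq_one (measurableSet_climbSet x 0)).2 ?_
    have h := hP.measureReal_climbSet x 0
    rw [Finset.prod_range_zero, measureReal_def, ENNReal.toReal_eq_one_iff] at h
    exact h
  have hstep : ∀ᵐ ω ∂P x, ∀ k, ω ∉ climbSet x k \ (climbSet x (k + 1) ∪ firstDropSet x k) :=
    ae_all_iff.2 fun k => measure_eq_zero_iff_ae_notMem.1 (hP.measure_climbSet_diff hlam.1 x k)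
  have hclimb := measure_eq_zero_iff_ae_notMem.1 (hP.measure_iInter_climbSet hlam x)
  filter_upwards [hstart, hstep, hclimb] with ω h0 hs hc
  by_contra! hno
  refine hc (Set.mem_iInter.2 fun n => ?_)
  induction n with
  | zero => exact h0
  | succ k ih =>
    by_contra hk
    exact hs k ⟨ih, fun hu => hu.elim hk (hno k)⟩

lemma IsUrnChain.measureReal_apply_betaTime_one {lam : ℝ} (hlam : lam ∈ Set.Ioo (0 : ℝ) 1)
    {P : ℤ → Measure (ℕ → ℤ)} (hP : IsUrnChain lam P) (x : ℤ) (k : ℕ) :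
    (P x).real {ω | ω (betaTime ω 1) = x + k - 1} =
      (∏ i ∈ Finset.range k, urnStep lam (x + i) (x + i + 1)) *
        urnStep lam (x + k) (x + k - 1) := by
  rw [← hP.measureReal_climbSet, ← hP.measureReal_firstDropSet]
  refine measureReal_congr ?_
  filter_upwards [hP.ae_exists_mem_firstDropSet hlam x] with ω ⟨m, hm⟩
  refine propext ⟨fun h => ?_, apply_betaTime_one_of_mem_firstDropSet⟩
  have h' : ω (betaTime ω 1) = x + k - 1 := h
  rw [apply_betaTime_one_of_mem_firstDropSet hm] at h'
  obtain rfl : m = k := by omega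
  exact hm

/-- Exact one-step ratio for the law of `𝔇_{β₁}`:
`P_x(𝔇_{β₁} = y+1) = (λ^{2y+1}/(1+λ^{2y+3})) P_x(𝔇_{β₁} = y)` whenever `y ≥ x - 1`;
in particular the ratio does not depend on the starting point `x`. -/
theorem urn_beta_one_ratio (lam : ℝ) (hlam : lam ∈ Set.Ioo (0 : ℝ) 1)
    (P : ℤ → Measure (ℕ → ℤ)) (hP : IsUrnChain lam P) :
    ∀ x y : ℤ, x - 1 ≤ y →
      (P x {ω | ω (betaTime ω 1) = y + 1}).toReal =
        lam ^ (2 * y + 1) / (1 + lam ^ (2 * y + 3)) *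
          (P x {ω | ω (betaTime ω 1) = y}).toReal := by
  intro x y hxy
  obtain ⟨k, hk⟩ := Int.eq_ofNat_of_zero_le (sub_nonneg.2 hxy)
  obtain rfl : y = x + k - 1 := by omega
  have hsucc := hP.measureReal_apply_betaTime_one hlam x (k + 1)
  rw [show x + ((k + 1 : ℕ) : ℤ) - 1 = x + k - 1 + 1 by push_cast; ring,
    show x + ((k + 1 : ℕ) : ℤ) = x + k + 1 by push_cast; ring, Finset.prod_range_succ,
    show x + (k : ℤ) - 1 + 1 = x + k + 1 - 1 by ring, urnStep_pred, urnStep_succ] at hsucc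
  have hk' := hP.measureReal_apply_betaTime_one hlam x k
  rw [urnStep_pred] at hk'
  rw [show x + (k : ℤ) - 1 + 1 = x + k + 1 - 1 by ring, ← measureReal_def, ← measureReal_def,
    hsucc, hk', show 2 * (x + (k : ℤ) - 1) + 1 = 2 * (x + k) - 1 by ring,
    show 2 * (x + (k : ℤ) - 1) + 3 = 2 * (x + k + 1) - 1 by ring]
  ring
end
end
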